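/- Fix λ₁ ∈ (0, 1/2]. For x, x₁ ∈ ℝ² define F(λ,x,x₁) := χ(λ|x−x₁|) Y0(λ|x−x₁|) − χ(λ(|x|+1)) Y0(λ(|x|+1)). Then there is a constant C (depending only on χ and λ₁) such that for all 0 < λ ≤ 2λ₁ and all x, x₁ ∈ ℝ² with x ≠ x₁: |∂_λ F(λ,x,x₁)| ≤ C/λ and |F(λ,x,x₁)| ≤ C k(x,x₁), where k(x,x₁) := 1 + log⁺|x₁| + log⁻|x−x₁|, with log⁻ y := |log y| for 0 < y < 1 and log⁻ y := 0 for y ≥ 1, and log⁺ y := log y for y > 1 and log⁺ y := 0 for 0 < y ≤ 1. -/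

import Mathlib

open MeasureTheory Real Set Complex Filter
open scoped ENNReal ComplexConjugate

noncomputable section

/-- The plane `ℝ²`. -/
abbrev R2 : Type := EuclideanSpace ℝ (Fin 2)

/-- The Bessel function `J₀`, defined by its power series. -/
def J0 (z : ℝ) : ℝ := ∑' k : ℕ, (-1 : ℝ) ^ k * (z / 2) ^ (2 * k) / ((Nat.factorial k : ℝ)) ^ 2

/-- The Bessel function `Y₀`. -/
def Y0 (z : ℝ) : ℝ :=
  (2 / π) * ((Real.log (z / 2) + Real.eulerMascheroniConstant) * J0 z +
    ∑' k : ℕ, (-1 : ℝ) ^ k * ((harmonic (k + 1) : ℝ)) * (z / 2) ^ (2 * (k + 1)) /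
      ((Nat.factorial (k + 1) : ℝ)) ^ 2)

/-- The Hankel functions `H₀^±`; the sign is recorded by `ε = ±1`. -/
def H0 (ε : ℝ) (z : ℝ) : ℂ := (J0 z : ℂ) + (ε : ℂ) * Complex.I * (Y0 z : ℂ)

/-- The Japanese bracket `⟨x⟩ = (1+|x|²)^{1/2}`. -/
def jap (x : R2) : ℝ := Real.sqrt (1 + ‖x‖ ^ 2)

/-- `log⁻ y = |log y|` for `0 < y < 1`, and `0` for `y ≥ 1`. -/
def logMinus (y : ℝ) : ℝ := if y < 1 then |Real.log y| else 0

/-- `log⁺ y = log y` for `y > 1`, and `0` for `0 < y ≤ 1`. -/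
def logPlus (y : ℝ) : ℝ := if 1 < y then Real.log y else 0

/-- `k(x,x₁) = 1 + log⁺|x₁| + log⁻|x-x₁|`. -/
def kfun (x x₁ : R2) : ℝ := 1 + logPlus ‖x₁‖ + logMinus (dist x x₁)

open FormalMultilinearSeries in
/-- A real power series with coefficients bounded by `1 / k!` has a smooth sum. -/
theorem contDiff_tsum_mul_pow_of_abs_le (a : ℕ → ℝ) (ha : ∀ k, |a k| ≤ 1 / (k.factorial : ℝ)) :
    ContDiff ℝ 1 (fun t : ℝ => ∑' k, a k * t ^ k) := by
  have hr : (ofScalars ℝ a).radius = ⊤ := by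
    refine ENNReal.eq_top_of_forall_nnreal_le fun r => le_radius_of_summable_norm _ ?_
    refine Summable.of_nonneg_of_le (fun k => by positivity) (fun k => ?_)
      (Real.summable_pow_div_factorial r)
    have h : ‖ofScalars ℝ a k‖ ≤ 1 / (k.factorial : ℝ) := by
      simpa [ofScalars_norm] using ha k
    calc ‖ofScalars ℝ a k‖ * (r : ℝ) ^ k ≤ 1 / (k.factorial : ℝ) * (r : ℝ) ^ k := by gcongr
      _ = _ := by ring
  have hp := (ofScalars ℝ a).hasFPowerSeriesOnBall (by rw [hr]; simp)
  rw [hr] at hp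
  have han : AnalyticOnNhd ℝ (ofScalars ℝ a).sum univ := fun x _ =>
    hp.analyticAt_of_mem (by simp)
  have heq : (ofScalars ℝ a).sum = fun t : ℝ => ∑' k, a k * t ^ k := by
    funext t
    simp [FormalMultilinearSeries.sum, mul_comm]
  rw [← heq]
  exact han.contDiff

theorem contDiff_J0 : ContDiff ℝ 1 J0 := by
  have h := contDiff_tsum_mul_pow_of_abs_le
    (fun k => (-1 : ℝ) ^ k / (k.factorial : ℝ) ^ 2) fun k => by
      have h1 : (1 : ℝ) ≤ k.factorial := by exact_mod_cast k.factorial_pos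
      rw [abs_div, abs_pow, abs_neg, abs_one, one_pow, abs_of_nonneg (by positivity)]
      gcongr
      nlinarith
  have h2 : ContDiff ℝ 1 (fun z : ℝ => (z / 2) ^ 2) := by fun_prop
  convert h.comp h2 using 1
  funext z
  simp only [J0, Function.comp]
  congr 1
  funext k
  rw [← pow_mul]
  ring

/-- The smooth part of `Y₀`. -/
def Y0Reg (z : ℝ) : ℝ :=
  ∑' k : ℕ, (-1 : ℝ) ^ k * ((harmonic (k + 1) : ℝ)) * (z / 2) ^ (2 * (k + 1)) /
    ((Nat.factorial (k + 1) : ℝ)) ^ 2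

theorem harmonic_le_self (n : ℕ) : harmonic n ≤ n := by
  unfold harmonic
  calc ∑ i ∈ Finset.range n, ((i + 1 : ℕ) : ℚ)⁻¹ ≤ ∑ i ∈ Finset.range n, (1 : ℚ) :=
        Finset.sum_le_sum fun i _ => inv_le_one_of_one_le₀ (by simp)
    _ = n := by simp

theorem contDiff_Y0Reg : ContDiff ℝ 1 Y0Reg := by
  have h := contDiff_tsum_mul_pow_of_abs_le
    (fun k => (-1 : ℝ) ^ k * (harmonic (k + 1) : ℝ) / ((k + 1).factorial : ℝ) ^ 2) fun k => by
      have h1 : (1 : ℝ) ≤ k.factorial := by exact_mod_cast k.factorial_pos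
      have h2 : (harmonic (k + 1) : ℝ) ≤ k + 1 := by exact_mod_cast harmonic_le_self (k + 1)
      have h3 : (0 : ℝ) ≤ (harmonic (k + 1) : ℝ) := by
        exact_mod_cast (harmonic_pos (Nat.succ_ne_zero k)).le
      rw [abs_div, abs_mul, abs_pow, abs_neg, abs_one, one_pow, one_mul, abs_of_nonneg h3,
        abs_of_nonneg (by positivity), div_le_div_iff₀ (by positivity) (by positivity),
        Nat.factorial_succ]
      push_cast
      have h4 : (0 : ℝ) ≤ k := k.cast_nonneg
      calc (harmonic (k + 1) : ℝ) * k.factorial ≤ (k + 1) * k.factorial := by gcongr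
        _ ≤ ((k + 1) * k.factorial) * ((k + 1) * k.factorial) :=
          le_mul_of_one_le_right (by positivity) (by nlinarith)
        _ = _ := by ring
  have h2 : ContDiff ℝ 1 (fun z : ℝ => (z / 2) ^ 2) := by fun_prop
  refine (funext fun z => ?_ : Y0Reg = _) ▸ h2.mul (h.comp h2)
  simp only [Y0Reg, Function.comp]
  rw [← tsum_mul_left]
  congr 1
  funext k
  rw [← pow_mul]
  ring

theorem Y0_eq (z : ℝ) :
    Y0 z = (2 / π) * ((Real.log (z / 2) + Real.eulerMascheroniConstant) * J0 z + Y0Reg z) :=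
  rfl

theorem hasDerivAt_Y0 {z : ℝ} (hz : z ≠ 0) :
    HasDerivAt Y0 ((2 / π) * (z⁻¹ * J0 z +
      (Real.log (z / 2) + Real.eulerMascheroniConstant) * deriv J0 z + deriv Y0Reg z)) z := by
  have hJ := (contDiff_J0.differentiable one_ne_zero z).hasDerivAt
  have hR := (contDiff_Y0Reg.differentiable one_ne_zero z).hasDerivAt
  have hl : HasDerivAt (fun y : ℝ => Real.log (y / 2) + Real.eulerMascheroniConstant) z⁻¹ z := by
    have h := ((hasDerivAt_id' z).div_const 2).log (div_ne_zero hz two_ne_zero)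
    exact (h.add_const Real.eulerMascheroniConstant).congr_deriv (by field_simp)
  exact ((hl.mul hJ).add hR).const_mul (2 / π)

/-- The logarithmic derivative `z g'(z)` of `g = χ Y₀` is bounded on `(0, ∞)`. -/
theorem exists_bound_mul_deriv_cutoff_mul_Y0 {χ : ℝ → ℝ} (hχ : ContDiff ℝ 1 χ)
    (hχ0 : ∀ z, 1 / 2 < z → χ z = 0) :
    ∃ C : ℝ, 0 ≤ C ∧ ∀ z : ℝ, 0 < z → ∃ d : ℝ,
      HasDerivAt (fun y => χ y * Y0 y) d z ∧ |z * d| ≤ C := by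
  have hJ := contDiff_J0.continuous
  have hR := contDiff_Y0Reg.continuous
  have hJ' := contDiff_J0.continuous_deriv le_rfl
  have hR' := contDiff_Y0Reg.continuous_deriv le_rfl
  have hχ' := hχ.continuous_deriv le_rfl
  have hc := hχ.continuous
  have hlog := Real.continuous_mul_log
  set L : ℝ → ℝ := fun z =>
    z * Real.log z + z * (Real.eulerMascheroniConstant - Real.log 2) with hL
  have hLc : Continuous L := by fun_prop
  set Φ : ℝ → ℝ := fun z => deriv χ z * ((2 / π) * (L z * J0 z + z * Y0Reg z)) +
    χ z * ((2 / π) * (J0 z + L z * deriv J0 z + z * deriv Y0Reg z)) with hΦ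
  have hΦc : Continuous Φ := by fun_prop
  obtain ⟨C, hC⟩ := (isCompact_Icc (a := (0 : ℝ)) (b := 1)).exists_bound_of_continuousOn
    hΦc.continuousOn
  refine ⟨C, (norm_nonneg _).trans (hC 0 (by simp)), fun z hz => ?_⟩
  rcases le_or_gt z 1 with h1 | h1
  · refine ⟨_, (hχ.differentiable one_ne_zero z).hasDerivAt.mul (hasDerivAt_Y0 hz.ne'), ?_⟩
    have := hC z ⟨hz.le, h1⟩
    rw [Real.norm_eq_abs] at this
    convert this using 2
    simp only [hΦ, hL, Y0_eq]
    rw [Real.log_div hz.ne' two_ne_zero]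
    field_simp
    ring
  · refine ⟨0, ?_, by simpa using (norm_nonneg _).trans (hC 0 (by simp))⟩
    refine (hasDerivAt_const z (0 : ℝ)).congr_of_eventuallyEq ?_
    filter_upwards [lt_mem_nhds h1] with y hy
    rw [hχ0 y (by linarith), zero_mul]

/-- A function with `|z g'(z)| ≤ C` on `(0, ∞)` is Lipschitz in the variable `log z`. -/
theorem abs_sub_le_mul_abs_log_sub_log {g : ℝ → ℝ} {C : ℝ}
    (hg : ∀ z : ℝ, 0 < z → ∃ d : ℝ, HasDerivAt g d z ∧ |z * d| ≤ C)
    {u v : ℝ} (hu : 0 < u) (hv : 0 < v) :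
    |g u - g v| ≤ C * |Real.log u - Real.log v| := by
  choose! d hd hb using hg
  have key := convex_univ.norm_image_sub_le_of_norm_hasDerivWithin_le
    (f := fun s => g (Real.exp s)) (f' := fun s => d (Real.exp s) * Real.exp s) (C := C)
    (x := Real.log v) (y := Real.log u)
    (fun s _ => ((hd _ (Real.exp_pos s)).comp s (Real.hasDerivAt_exp s)).hasDerivWithinAt)
    (fun s _ => by rw [mul_comm]; exact hb _ (Real.exp_pos s)) (mem_univ _) (mem_univ _)
  simpa [Real.exp_log hu, Real.exp_log hv] using key

theorem log_add_le_logPlus {c y : ℝ} (hc : 0 ≤ c) (hcy : 0 < c + y) :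
    Real.log (c + y) ≤ c + logPlus y := by
  unfold logPlus
  split_ifs with h
  · have h1 : Real.log (c + y) ≤ Real.log ((c + 1) * y) := by
      apply Real.log_le_log hcy
      nlinarith
    rw [Real.log_mul (by positivity) (by positivity)] at h1
    have := Real.log_le_sub_one_of_pos (show 0 < c + 1 by positivity)
    linarith
  · have := Real.log_le_sub_one_of_pos hcy
    linarith

theorem abs_log_dist_sub_log_le (x x₁ : R2) (hx : x ≠ x₁) :
    |Real.log (dist x x₁) - Real.log (‖x‖ + 1)| ≤ 2 * kfun x x₁ := by
  have hr : 0 < dist x x₁ := dist_pos.2 hx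
  have hn := norm_nonneg x
  have hn1 := norm_nonneg x₁
  have hrle : dist x x₁ ≤ ‖x‖ + ‖x₁‖ := dist_le_norm_add_norm x x₁
  have hxle : ‖x‖ ≤ dist x x₁ + ‖x₁‖ := by
    rw [dist_eq_norm]; simpa using norm_add_le (x - x₁) x₁
  have h1 := log_add_le_logPlus zero_le_one (y := ‖x₁‖) (by positivity)
  have h2 := log_add_le_logPlus zero_le_two (y := ‖x₁‖) (by positivity)
  have hp : 0 ≤ logPlus ‖x₁‖ := by
    unfold logPlus; split_ifs with h
    exacts [Real.log_nonneg h.le, le_rfl]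
  have hm : 0 ≤ logMinus (dist x x₁) := by
    unfold logMinus; split_ifs
    exacts [abs_nonneg _, le_rfl]
  unfold kfun
  rw [abs_le]
  constructor
  · have : Real.log (‖x‖ + 1) ≤
        Real.log (2 + ‖x₁‖) + Real.log (dist x x₁) + logMinus (dist x x₁) := by
      unfold logMinus
      split_ifs with h
      · have h3 := Real.log_le_log (by positivity) (show ‖x‖ + 1 ≤ 2 + ‖x₁‖ by linarith)
        have h4 := neg_abs_le (Real.log (dist x x₁))
        linarith
      · rw [← Real.log_mul (by positivity) hr.ne', add_zero]
        apply Real.log_le_log (by positivity)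
        push Not at h
        nlinarith
    linarith
  · have : Real.log (dist x x₁) ≤ Real.log (1 + ‖x₁‖) + Real.log (‖x‖ + 1) := by
      rw [← Real.log_mul (by positivity) (by positivity)]
      apply Real.log_le_log hr
      nlinarith [mul_nonneg hn hn1]
    linarith

/-- **Bounds on the auxiliary low-energy function `F`** (part of Lemma `lem:FG` of the paper).
For `F(λ,x,x₁) = χ(λ|x-x₁|)Y₀(λ|x-x₁|) - χ(λ(|x|+1))Y₀(λ(|x|+1))` one has
`|∂_λ F(λ,x,x₁)| ≤ C/λ` and `|F(λ,x,x₁)| ≤ C k(x,x₁)` for all `0 < λ ≤ 2λ₁` and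
`x ≠ x₁`. -/
theorem lowEnergy_F_bounds
    (lam1 : ℝ) (hlam1 : 0 < lam1 ∧ lam1 ≤ 1/2)
    (χ : ℝ → ℝ) (hχsmooth : ContDiff ℝ (⊤ : ℕ∞) χ) (hχeven : ∀ x, χ (-x) = χ x)
    (hχone : ∀ x ∈ Icc (-(lam1/2)) (lam1/2), χ x = 1)
    (hχsupp : Function.support χ ⊆ Icc (-lam1) lam1)
    (hχrange : ∀ x, 0 ≤ χ x ∧ χ x ≤ 1) :
    ∃ C : ℝ, 0 ≤ C ∧
      ∀ lam : ℝ, 0 < lam → lam ≤ 2 * lam1 → ∀ x x₁ : R2, x ≠ x₁ →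
      (|deriv (fun l : ℝ => χ (l * dist x x₁) * Y0 (l * dist x x₁) -
          χ (l * (‖x‖ + 1)) * Y0 (l * (‖x‖ + 1))) lam| ≤ C / lam) ∧
      (|χ (lam * dist x x₁) * Y0 (lam * dist x x₁) -
          χ (lam * (‖x‖ + 1)) * Y0 (lam * (‖x‖ + 1))| ≤ C * kfun x x₁) := by
  obtain ⟨C, hC0, hC⟩ := exists_bound_mul_deriv_cutoff_mul_Y0
    (hχsmooth.of_le (by exact_mod_cast le_top)) fun z hz => by
      by_contra hne
      have := (hχsupp hne).2
      linarith [hlam1.2]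
  refine ⟨2 * C, by positivity, fun lam hlam _ x x₁ hx => ?_⟩
  have hr : 0 < dist x x₁ := dist_pos.2 hx
  have hn : 0 < ‖x‖ + 1 := by positivity
  constructor
  · obtain ⟨d, hd, hdb⟩ := hC (lam * dist x x₁) (by positivity)
    obtain ⟨e, he, heb⟩ := hC (lam * (‖x‖ + 1)) (by positivity)
    have hd' := hd.comp lam (hasDerivAt_mul_const (dist x x₁))
    have he' := he.comp lam (hasDerivAt_mul_const (‖x‖ + 1))
    refine (congrArg abs (hd'.sub he').deriv).trans_le ?_
    rw [le_div_iff₀ hlam]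
    calc |d * dist x x₁ - e * (‖x‖ + 1)| * lam
        = |lam * dist x x₁ * d - lam * (‖x‖ + 1) * e| := by
          rw [← abs_of_pos hlam, ← abs_mul, abs_of_pos hlam]; ring_nf
      _ ≤ |lam * dist x x₁ * d| + |lam * (‖x‖ + 1) * e| := abs_sub _ _
      _ ≤ 2 * C := by linarith
  · have h := abs_sub_le_mul_abs_log_sub_log hC (mul_pos hlam hr) (mul_pos hlam hn)
    rw [Real.log_mul hlam.ne' hr.ne', Real.log_mul hlam.ne' hn.ne', add_sub_add_left_eq_sub] at h
    calc _ ≤ _ := h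
      _ ≤ C * (2 * kfun x x₁) := by gcongr; exact abs_log_dist_sub_log_le x x₁ hx
      _ = _ := by ring
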